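/- arXiv:1602.06586 — 3 statements merged into one kernel-verified Lean document; each statement's English description precedes it below -/
import Mathlib

section
/- There is a positive universal constant C such that the following holds. Let v ∈ ℝ^M, let E be a symmetric M×M real matrix, and set X = vvᵀ + E. Let v̂v̂ᵀ be the rank-1 truncated SVD of X (i.e., v̂ = √σ₁·u₁ where σ₁ is the largest singular value of X and u₁ a corresponding unit singular vector). Then min{‖v − v̂‖₂, ‖v + v̂‖₂} ≤ min{ C·‖E‖^{1/2}, C·‖E‖/‖v‖₂ }, where ‖E‖ is the spectral norm. -/
open Matrix
open scoped Classical

/-- The spectral (operator `ℓ²→ℓ²`) norm of a real matrix. -/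
noncomputable def specNorm {m n : ℕ} (A : Matrix (Fin m) (Fin n) ℝ) : ℝ :=
  ‖LinearMap.toContinuousLinearMap (Matrix.toEuclideanLin A)‖

/-- The Euclidean norm of a vector. -/
noncomputable def euclNorm {m : ℕ} (v : Fin m → ℝ) : ℝ :=
  Real.sqrt (∑ i, v i ^ 2)

open scoped RealInnerProductSpace

section RankOnePerturbation

variable {F : Type*} [NormedAddCommGroup F] [InnerProductSpace ℝ F]

/-- The norm of a perturbed rank-one operator is at most `‖v‖ ^ 2 + ‖E‖`. -/
lemma norm_rankOne_add_le {v : F} {E T : F →L[ℝ] F} (hT : ∀ x, T x = ⟪v, x⟫ • v + E x) :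
    ‖T‖ ≤ ‖v‖ ^ 2 + ‖E‖ := by
  refine T.opNorm_le_bound (by positivity) fun x => ?_
  rw [hT]
  calc ‖⟪v, x⟫ • v + E x‖ ≤ ‖⟪v, x⟫ • v‖ + ‖E x‖ := norm_add_le _ _
    _ ≤ (‖v‖ * ‖x‖) * ‖v‖ + ‖E‖ * ‖x‖ := by
      rw [norm_smul]
      gcongr
      · exact norm_inner_le_norm v x
      · exact E.le_opNorm x
    _ = _ := by ring

/-- The norm of a perturbed rank-one operator is at least `‖v‖ ^ 2 - ‖E‖`. -/
lemma le_norm_rankOne_add {v : F} {E T : F →L[ℝ] F} (hT : ∀ x, T x = ⟪v, x⟫ • v + E x) :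
    ‖v‖ ^ 2 ≤ ‖T‖ + ‖E‖ := by
  rcases (norm_nonneg v).eq_or_lt with h | h
  · rw [← h, zero_pow two_ne_zero]; positivity
  · have h1 : ‖⟪v, v⟫ • v‖ ≤ ‖T v‖ + ‖E v‖ := by
      rw [show ⟪v, v⟫ • v = T v - E v by rw [hT]; abel]
      exact norm_sub_le _ _
    rw [norm_smul, real_inner_self_eq_norm_sq, Real.norm_of_nonneg (by positivity)] at h1
    have h2 := T.le_opNorm v
    have h3 := E.le_opNorm v
    exact le_of_mul_le_mul_right (by linarith) h

/-- Perturbation bound for a positive eigenvalue `s` whose unit eigenvector `u` makes an acute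
angle with `v`. -/
lemma norm_sub_sqrt_smul_mul_le {v u : F} {E : F →L[ℝ] F} {s : ℝ} (hu : ‖u‖ = 1) (hs : 0 < s)
    (ha : 0 ≤ ⟪v, u⟫) (heig : ⟪v, u⟫ • v + E u = s • u)
    (hdiff : |⟪v, u⟫ ^ 2 - s| ≤ ‖E‖) :
    ‖v - √s • u‖ * ⟪v, u⟫ ≤ 2 * ‖E‖ := by
  set a := ⟪v, u⟫ with ha_def
  have hr : 0 < √s := Real.sqrt_pos.2 hs
  have hss : √s * √s = s := Real.mul_self_sqrt hs.le
  have hsplit : a • (v - √s • u) = -(E u) + (s - a * √s) • u := by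
    have : a • v = s • u - E u := by rw [← heig]; abel
    rw [smul_sub, this, sub_smul, smul_smul]; abel
  have hEu : ‖E u‖ ≤ ‖E‖ := by simpa [hu] using E.le_opNorm u
  have hcoef : |s - a * √s| ≤ ‖E‖ := by
    refine le_trans ?_ hdiff
    have e1 : s - a * √s = √s * (√s - a) := by rw [mul_sub, hss]; ring
    have e2 : a ^ 2 - s = (√s + a) * (a - √s) := by nlinarith
    rw [e1, e2, abs_mul, abs_mul, abs_of_pos hr, abs_of_nonneg (by positivity : 0 ≤ √s + a),
      abs_sub_comm a]
    gcongr
    linarith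
  calc ‖v - √s • u‖ * a = ‖a • (v - √s • u)‖ := by
        rw [norm_smul, Real.norm_of_nonneg ha, mul_comm]
    _ ≤ ‖-(E u)‖ + ‖(s - a * √s) • u‖ := by rw [hsplit]; exact norm_add_le _ _
    _ ≤ 2 * ‖E‖ := by
      rw [norm_neg, norm_smul, hu, Real.norm_eq_abs]; linarith

/-- Wedin-type bound for rank-one perturbations, in product form. -/
lemma min_norm_sub_add_sqrt_smul_le {v u : F} {E T : F →L[ℝ] F} {μ : ℝ}
    (hT : ∀ x, T x = ⟪v, x⟫ • v + E x) (hu : ‖u‖ = 1) (heig : T u = μ • u) (hμ : |μ| = ‖T‖) :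
    min ‖v - √‖T‖ • u‖ ‖v + √‖T‖ • u‖ ≤ 10 * √‖E‖ ∧
      min ‖v - √‖T‖ • u‖ ‖v + √‖T‖ • u‖ * ‖v‖ ≤ 10 * ‖E‖ := by
  have hup := norm_rankOne_add_le hT
  have hlow := le_norm_rankOne_add hT
  have he : 0 ≤ ‖E‖ := norm_nonneg E
  have hn : 0 ≤ ‖v‖ := norm_nonneg v
  have hsE : √‖E‖ * √‖E‖ = ‖E‖ := Real.mul_self_sqrt he
  have hrE : 0 ≤ √‖E‖ := Real.sqrt_nonneg _
  rcases le_or_gt (‖v‖ ^ 2) (4 * ‖E‖) with hsmall | hlarge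
  · have hd : min ‖v - √‖T‖ • u‖ ‖v + √‖T‖ • u‖ ≤ ‖v‖ + √‖T‖ := by
      refine (min_le_left _ _).trans ((norm_sub_le _ _).trans ?_)
      rw [norm_smul, hu, Real.norm_of_nonneg (Real.sqrt_nonneg _), mul_one]
    have h1 : ‖v‖ ≤ 2 * √‖E‖ := by
      refine le_of_sq_le_sq ?_ (by positivity)
      nlinarith
    have h2 : √‖T‖ ≤ 3 * √‖E‖ := by
      rw [Real.sqrt_le_left (by positivity)]
      nlinarith
    refine ⟨by linarith, ?_⟩
    calc _ ≤ (5 * √‖E‖) * (2 * √‖E‖) := by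
          gcongr
          linarith
      _ = 10 * ‖E‖ := by linear_combination 10 * hsE
  · have hEu : |⟪u, E u⟫| ≤ ‖E‖ := by
      refine (abs_real_inner_le_norm _ _).trans ?_
      simpa [hu] using E.le_opNorm u
    have heig' : ⟪v, u⟫ • v + E u = μ • u := by rw [← hT, heig]
    have hin : ⟪v, u⟫ ^ 2 - μ = -⟪u, E u⟫ := by
      have h := congrArg (fun x => ⟪u, x⟫) heig'
      simp only [inner_add_right, real_inner_smul_right, real_inner_self_eq_norm_sq, hu,
        real_inner_comm v u] at h
      linarith [real_inner_comm u v]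
    have hdiff : |⟪v, u⟫ ^ 2 - μ| ≤ ‖E‖ := by rwa [hin, abs_neg]
    have hpos : 0 < μ := by
      by_contra! h
      rw [abs_of_nonpos h] at hμ
      nlinarith [abs_le.1 hdiff, sq_nonneg ⟪v, u⟫]
    rw [abs_of_pos hpos] at hμ
    rw [← hμ]
    rw [← hμ] at hlow
    have hmain : min ‖v - √μ • u‖ ‖v + √μ • u‖ * |⟪v, u⟫| ≤ 2 * ‖E‖ := by
      rcases le_total 0 ⟪v, u⟫ with h | h
      · rw [abs_of_nonneg h]
        exact (mul_le_mul_of_nonneg_right (min_le_left _ _) h).trans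
          (norm_sub_sqrt_smul_mul_le hu hpos h heig' hdiff)
      · have key := norm_sub_sqrt_smul_mul_le (v := v) (u := -u) (E := E) (s := μ)
          (by rwa [norm_neg]) hpos (by rw [inner_neg_right]; linarith)
          (by rw [inner_neg_right, neg_smul, map_neg, smul_neg, ← heig']; abel)
          (by rwa [inner_neg_right, neg_sq])
        rw [inner_neg_right, smul_neg, sub_neg_eq_add] at key
        rw [abs_of_nonpos h]
        exact (mul_le_mul_of_nonneg_right (min_le_right _ _) (by linarith)).trans key
    set d := min ‖v - √μ • u‖ ‖v + √μ • u‖ with hd_def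
    have hd : 0 ≤ d := le_min (norm_nonneg _) (norm_nonneg _)
    have ha : ‖v‖ ≤ 2 * |⟪v, u⟫| := by
      refine le_of_sq_le_sq ?_ (by positivity)
      rw [mul_pow, sq_abs]
      nlinarith [(abs_le.1 hdiff).1]
    have hdv : d * ‖v‖ ≤ 4 * ‖E‖ := by
      nlinarith [mul_le_mul_of_nonneg_left ha hd]
    refine ⟨?_, by linarith⟩
    have hvpos : 0 < ‖v‖ := by
      refine hn.lt_of_ne fun h => ?_
      rw [← h] at hlarge
      linarith
    have hEv : √‖E‖ ≤ ‖v‖ := by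
      rw [Real.sqrt_le_left hn]
      linarith
    refine le_of_mul_le_mul_right ?_ hvpos
    nlinarith [mul_le_mul_of_nonneg_left hEv hrE]

end RankOnePerturbation

lemma euclNorm_eq_norm_toLp {m : ℕ} (v : Fin m → ℝ) : euclNorm v = ‖WithLp.toLp 2 v‖ := by
  simp [euclNorm, EuclideanSpace.norm_eq]

/-- Wedin's theorem applied to rank-1 matrices.  If `X = vvᵀ + E` with `E`
symmetric, and `v̂ = √σ₁ · u₁` where `σ₁` is the largest singular value of `X` (the spectral
norm) and `u₁` a corresponding unit singular vector (an eigenvector of the symmetric matrix `X`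
whose eigenvalue has absolute value `σ₁`), then
`min {‖v − v̂‖, ‖v + v̂‖} ≤ min {C‖E‖^{1/2}, C‖E‖/‖v‖}`. -/
theorem stmt12 :
    ∃ C : ℝ, 0 < C ∧
      ∀ (M : ℕ) (v : Fin M → ℝ) (E : Matrix (Fin M) (Fin M) ℝ), Eᵀ = E →
        ∀ (u : Fin M → ℝ) (μ : ℝ),
          euclNorm u = 1 →
          (Matrix.vecMulVec v v + E).mulVec u = μ • u →
          |μ| = specNorm (Matrix.vecMulVec v v + E) →
          ∀ vhat : Fin M → ℝ,
            vhat = Real.sqrt (specNorm (Matrix.vecMulVec v v + E)) • u →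
            min (euclNorm (v - vhat)) (euclNorm (v + vhat)) ≤
                C * Real.sqrt (specNorm E) ∧
              (euclNorm v ≠ 0 →
                min (euclNorm (v - vhat)) (euclNorm (v + vhat)) ≤
                  C * specNorm E / euclNorm v) := by
  refine ⟨10, by norm_num, fun M v E _ u μ hu heig hμ vhat hvhat => ?_⟩
  have hT : ∀ x, LinearMap.toContinuousLinearMap
      (Matrix.toEuclideanLin (Matrix.vecMulVec v v + E)) x =
      ⟪WithLp.toLp 2 v, x⟫ • WithLp.toLp 2 v +
        LinearMap.toContinuousLinearMap (Matrix.toEuclideanLin E) x := by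
    intro x
    ext i
    simp [Matrix.toLpLin_apply, Matrix.vecMulVec_mulVec,
      EuclideanSpace.inner_eq_star_dotProduct, dotProduct_comm, mul_comm]
  obtain ⟨h1, h2⟩ := min_norm_sub_add_sqrt_smul_le (u := WithLp.toLp 2 u) (μ := μ) hT
    (by rw [← euclNorm_eq_norm_toLp, hu])
    (by
      rw [LinearMap.coe_toContinuousLinearMap', Matrix.toLpLin_toLp, ← WithLp.toLp_smul]
      exact congrArg _ heig) hμ
  rw [← WithLp.toLp_smul, ← WithLp.toLp_sub, ← WithLp.toLp_add] at h1 h2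
  simp only [← euclNorm_eq_norm_toLp] at h1 h2
  subst hvhat
  refine ⟨h1, fun hv => ?_⟩
  have hv' : 0 < euclNorm v := (Real.sqrt_nonneg _).lt_of_ne' hv
  rw [le_div_iff₀ hv']
  exact h2
end

section
/- Let U be a real M×R matrix and let Pr be an M×M orthogonal projection matrix (Pr² = Pr = Prᵀ). Then ‖U − Pr·U‖² ≤ ‖U·Uᵀ − (Pr·U)(Pr·U)ᵀ‖, where ‖·‖ denotes the spectral (operator) norm. -/
open Matrix
open scoped Classical

open scoped Matrix.Norms.L2Operator in
theorem specNorm_eq_l2_opNorm {m n : ℕ} (A : Matrix (Fin m) (Fin n) ℝ) : specNorm A = ‖A‖ := by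
  rw [Matrix.l2_opNorm_def]
  rfl

theorem specNorm_nonneg {m n : ℕ} (A : Matrix (Fin m) (Fin n) ℝ) : 0 ≤ specNorm A :=
  norm_nonneg _

theorem specNorm_mul_le {l m n : ℕ} (A : Matrix (Fin l) (Fin m) ℝ)
    (B : Matrix (Fin m) (Fin n) ℝ) : specNorm (A * B) ≤ specNorm A * specNorm B := by
  simpa only [specNorm_eq_l2_opNorm] using Matrix.l2_opNorm_mul A B

theorem specNorm_mul_transpose_self {m n : ℕ} (A : Matrix (Fin m) (Fin n) ℝ) :
    specNorm (A * Aᵀ) = specNorm A ^ 2 := by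
  have h := Matrix.l2_opNorm_conjTranspose_mul_self Aᴴ
  rw [Matrix.conjTranspose_conjTranspose, Matrix.l2_opNorm_conjTranspose,
    Matrix.conjTranspose_eq_transpose_of_trivial] at h
  rw [specNorm_eq_l2_opNorm, specNorm_eq_l2_opNorm, h, sq]

/-- An orthogonal projection matrix has spectral norm at most one. -/
theorem specNorm_le_one_of_projection {m : ℕ} {Q : Matrix (Fin m) (Fin m) ℝ}
    (hidem : Q * Q = Q) (hsymm : Qᵀ = Q) : specNorm Q ≤ 1 := by
  have h := specNorm_mul_transpose_self Q
  rw [hsymm, hidem] at h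
  nlinarith [sq_nonneg (specNorm Q - 1)]

/-- for a real `M×R` matrix `U` and an orthogonal projection matrix `Pr`,
`‖U − Pr·U‖² ≤ ‖UUᵀ − (Pr·U)(Pr·U)ᵀ‖` in spectral norm. -/
theorem stmt13 (M R : ℕ) (U : Matrix (Fin M) (Fin R) ℝ)
    (Pr : Matrix (Fin M) (Fin M) ℝ) (hidem : Pr * Pr = Pr) (hsymm : Prᵀ = Pr) :
    specNorm (U - Pr * U) ^ 2 ≤ specNorm (U * Uᵀ - (Pr * U) * (Pr * U)ᵀ) := by
  set D := U * Uᵀ - (Pr * U) * (Pr * U)ᵀ with hD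
  have hQ : specNorm (1 - Pr) ≤ 1 := by
    apply specNorm_le_one_of_projection
    · simp [sub_mul, mul_sub, hidem]
    · simp [hsymm]
  have hQP : (1 - Pr) * Pr = 0 := by rw [sub_mul, one_mul, hidem, sub_self]
  have key : (U - Pr * U) * (U - Pr * U)ᵀ = (1 - Pr) * D * (1 - Pr) := by
    have hU : U - Pr * U = (1 - Pr) * U := by rw [Matrix.sub_mul, Matrix.one_mul]
    have hz : (1 - Pr) * ((Pr * U) * (Pr * U)ᵀ) = 0 := by
      rw [← Matrix.mul_assoc, ← Matrix.mul_assoc, hQP, Matrix.zero_mul, Matrix.zero_mul]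
    rw [hU, hD, Matrix.mul_sub (1 - Pr), hz, sub_zero, Matrix.transpose_mul,
      Matrix.transpose_sub, Matrix.transpose_one, hsymm]
    simp only [Matrix.mul_assoc]
  rw [← specNorm_mul_transpose_self, key]
  calc specNorm ((1 - Pr) * D * (1 - Pr))
      ≤ specNorm ((1 - Pr) * D) * specNorm (1 - Pr) := specNorm_mul_le _ _
    _ ≤ specNorm ((1 - Pr) * D) := mul_le_of_le_one_right (specNorm_nonneg _) hQ
    _ ≤ specNorm (1 - Pr) * specNorm D := specNorm_mul_le _ _
    _ ≤ specNorm D := mul_le_of_le_one_left (specNorm_nonneg _) hQ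
end

section
/- Fix c with 0 ≤ c < 3/2 and let n be even with k = ⌊cn⌋. Let P′_n be the law of k i.i.d. uniform draws from {1,...,n}, and let P_n be the law of the first k observations of a 2-state HMM drawn as follows: a uniformly random subset S₁ ⊂ {1,...,n} of size n/2 is chosen; the hidden chain is symmetric on {+,−} with switching probability 1/4 and uniform initial state; in state + the emission is Uniform(S₁) and in state − it is Uniform({1,...,n}∖S₁). Then the total variation distance satisfies d_TV(P_n, P′_n) ≤ (1/2)·√( √(2/(2 − 4c/3)) − 1 ) + o_n(1). Consequently no algorithm can distinguish a length-⌊cn⌋ sequence from this HMM mixture from a uniformly random sequence with success probability exceeding 1/2 + O(√(√(2/(2 − 4c/3)) − 1)). -/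
open Finset Filter
open scoped Classical BigOperators

noncomputable section

/-- Probability that a 2-state HMM with transition matrix `T` and emission densities `e`
emits the list `l`, starting from hidden state `s`. -/
def hmmCond {M : ℕ} (T : Bool → Bool → ℝ) (e : Bool → Fin M → ℝ) :
    Bool → List (Fin M) → ℝ
  | _, [] => 1
  | s, x :: xs => e s x * ∑ s' : Bool, T s s' * hmmCond T e s' xs

/-- Output law of a 2-state HMM with transition matrix `T`, initial state distribution `π₀`
and emission densities `e`. -/
def hmmLaw {M : ℕ} (T : Bool → Bool → ℝ) (π₀ : Bool → ℝ) (e : Bool → Fin M → ℝ)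
    (l : List (Fin M)) : ℝ :=
  ∑ s : Bool, π₀ s * hmmCond T e s l

/-- The symmetric 2-state transition matrix with switching probability 1/4. -/
def Tq : Bool → Bool → ℝ := fun s s' => if s = s' then 3 / 4 else 1 / 4

/-- Emission densities: uniform on `S` in state `true`, uniform on `Sᶜ` in state `false`. -/
def emitHalf (n : ℕ) (S : Finset (Fin n)) : Bool → Fin n → ℝ := fun b i =>
  if (i ∈ S ↔ b = true) then 2 / (n : ℝ) else 0

/-- `P_n`: the mixture over a uniformly random half-subset `S₁` of the output laws of the
corresponding 2-state HMMs (switching probability 1/4, uniform initial state). -/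
def Pmix (n k : ℕ) (G : Fin k → Fin n) : ℝ :=
  (∑ S ∈ (Finset.univ : Finset (Fin n)).powersetCard (n / 2),
      hmmLaw Tq (fun _ => 1 / 2) (emitHalf n S) (List.ofFn G)) /
    (((Finset.univ : Finset (Fin n)).powersetCard (n / 2)).card : ℝ)

/-- `P′_n`: the law of `k` i.i.d. uniform draws from `{1,…,n}`. -/
def Punif (n k : ℕ) (_G : Fin k → Fin n) : ℝ := (1 / (n : ℝ)) ^ k

/-- The `±1`-valued indicator of membership in `S`. -/
def memSign {n : ℕ} (S : Finset (Fin n)) (i : Fin n) : ℝ := if i ∈ S then 1 else -1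

/-- The signed overlap `#(S' ∩ S) - #(S' \ S)`. -/
def signedOverlap {n : ℕ} (S S' : Finset (Fin n)) : ℝ := ∑ i ∈ S', memSign S i

/-- The sign attached to a hidden state. -/
def stateSign (b : Bool) : ℝ := if b then 1 else -1

lemma sum_memSign {n m : ℕ} (hn : n = 2 * m) {S : Finset (Fin n)} (hS : S.card = m) :
    ∑ i, memSign S i = 0 := by
  have h : ∀ i, memSign S i = 2 * (if i ∈ S then (1 : ℝ) else 0) - 1 := by
    intro i
    unfold memSign
    split_ifs <;> norm_num
  simp only [h, Finset.sum_sub_distrib, ← Finset.mul_sum]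
  simp [hS, hn]

lemma sum_memSign_mul_memSign {n m : ℕ} (hn : n = 2 * m) {S : Finset (Fin n)} (hS : S.card = m)
    (S' : Finset (Fin n)) :
    ∑ i, memSign S i * memSign S' i = 2 * signedOverlap S S' := by
  have h : ∀ i, memSign S i * memSign S' i =
      2 * (if i ∈ S' then memSign S i else 0) - memSign S i := by
    intro i
    have : memSign S' i = if i ∈ S' then 1 else -1 := rfl
    rw [this]
    split_ifs <;> ring
  simp only [h, Finset.sum_sub_distrib, ← Finset.mul_sum, sum_memSign hn hS]
  simp [signedOverlap]

lemma emitHalf_eq {n : ℕ} (S : Finset (Fin n)) (b : Bool) (i : Fin n) :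
    emitHalf n S b i = (1 + stateSign b * memSign S i) / n := by
  unfold emitHalf stateSign memSign
  cases b <;> by_cases h : i ∈ S <;> simp [h] <;> norm_num

lemma sum_emitHalf {n m : ℕ} (hn : n = 2 * m) (hm : 0 < m) {S : Finset (Fin n)}
    (hS : S.card = m) (b : Bool) : ∑ i, emitHalf n S b i = 1 := by
  have hn0 : (n : ℝ) ≠ 0 := by
    have : n ≠ 0 := by omega
    exact_mod_cast this
  simp only [emitHalf_eq, ← Finset.sum_div, Finset.sum_add_distrib, ← Finset.mul_sum,
    sum_memSign hn hS]
  simp [hn0]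

lemma sum_emitHalf_mul_emitHalf {n m : ℕ} (hn : n = 2 * m) (hm : 0 < m) {S S' : Finset (Fin n)}
    (hS : S.card = m) (hS' : S'.card = m) (b b' : Bool) :
    (n : ℝ) * ∑ i, emitHalf n S b i * emitHalf n S' b' i =
      1 + stateSign b * stateSign b' * (signedOverlap S S' / m) := by
  have hm0 : (m : ℝ) ≠ 0 := by exact_mod_cast hm.ne'
  have hnm : (n : ℝ) = 2 * m := by exact_mod_cast hn
  have h : ∀ i, emitHalf n S b i * emitHalf n S' b' i =
      (1 + stateSign b * memSign S i + stateSign b' * memSign S' i +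
        stateSign b * stateSign b' * (memSign S i * memSign S' i)) / (n : ℝ) ^ 2 := by
    intro i
    rw [emitHalf_eq, emitHalf_eq]
    ring
  simp only [h, ← Finset.sum_div, Finset.sum_add_distrib, ← Finset.mul_sum,
    sum_memSign hn hS, sum_memSign hn hS', sum_memSign_mul_memSign hn hS S']
  simp only [Finset.sum_const, Finset.card_univ, Fintype.card_fin, nsmul_eq_mul, hnm]
  field_simp
  ring

lemma sum_fin_succ_fun {n k : ℕ} (F : List (Fin n) → ℝ) :
    ∑ G : Fin (k + 1) → Fin n, F (List.ofFn G) =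
      ∑ x : Fin n, ∑ G : Fin k → Fin n, F (x :: List.ofFn G) := by
  rw [← Fintype.sum_prod_type' (f := fun (x : Fin n) (G : Fin k → Fin n) => F (x :: List.ofFn G))]
  symm
  refine Fintype.sum_equiv (Fin.consEquiv (fun _ => Fin n)) _ _ ?_
  rintro ⟨x, G⟩
  simp [Fin.consEquiv, List.ofFn_succ]

lemma sum_hmmCond {n : ℕ} {T : Bool → Bool → ℝ} {e : Bool → Fin n → ℝ}
    (hT : ∀ s, ∑ s', T s s' = 1) (he : ∀ s, ∑ i, e s i = 1) (k : ℕ) (s : Bool) :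
    ∑ G : Fin k → Fin n, hmmCond T e s (List.ofFn G) = 1 := by
  induction k generalizing s with
  | zero => simp [hmmCond]
  | succ k ih =>
    rw [sum_fin_succ_fun]
    simp only [hmmCond, ← Finset.mul_sum]
    rw [← Finset.sum_mul, he, Finset.sum_comm, one_mul]
    simp only [← Finset.mul_sum, ih, mul_one, hT]

/-- The unnormalised correlation, under the uniform law, of two conditional HMM laws. -/
def hmmCorr (n k : ℕ) (S S' : Finset (Fin n)) (s s' : Bool) : ℝ :=
  (n : ℝ) ^ k * ∑ G : Fin k → Fin n,
    hmmCond Tq (emitHalf n S) s (List.ofFn G) * hmmCond Tq (emitHalf n S') s' (List.ofFn G)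

lemma hmmCorr_succ {n m : ℕ} (hn : n = 2 * m) (hm : 0 < m) {S S' : Finset (Fin n)}
    (hS : S.card = m) (hS' : S'.card = m) (k : ℕ) (s s' : Bool) :
    hmmCorr n (k + 1) S S' s s' =
      (1 + stateSign s * stateSign s' * (signedOverlap S S' / m)) *
        ∑ u, ∑ u', Tq s u * Tq s' u' * hmmCorr n k S S' u u' := by
  rw [← sum_emitHalf_mul_emitHalf hn hm hS hS']
  unfold hmmCorr
  rw [sum_fin_succ_fun (fun l => hmmCond Tq (emitHalf n S) s l * hmmCond Tq (emitHalf n S') s' l)]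
  simp only [hmmCond, Fintype.sum_bool]
  have h : ∀ (x : Fin n), ∑ G : Fin k → Fin n,
      (emitHalf n S s x * (Tq s true * hmmCond Tq (emitHalf n S) true (List.ofFn G) +
          Tq s false * hmmCond Tq (emitHalf n S) false (List.ofFn G)) *
        (emitHalf n S' s' x * (Tq s' true * hmmCond Tq (emitHalf n S') true (List.ofFn G) +
          Tq s' false * hmmCond Tq (emitHalf n S') false (List.ofFn G)))) =
      (emitHalf n S s x * emitHalf n S' s' x) * ∑ G : Fin k → Fin n,
        ((Tq s true * hmmCond Tq (emitHalf n S) true (List.ofFn G) +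
          Tq s false * hmmCond Tq (emitHalf n S) false (List.ofFn G)) *
        (Tq s' true * hmmCond Tq (emitHalf n S') true (List.ofFn G) +
          Tq s' false * hmmCond Tq (emitHalf n S') false (List.ofFn G))) := by
    intro x
    rw [Finset.mul_sum]
    refine Finset.sum_congr rfl fun G _ => ?_
    ring
  simp only [h, ← Finset.sum_mul]
  have h2 : ∑ G : Fin k → Fin n,
        ((Tq s true * hmmCond Tq (emitHalf n S) true (List.ofFn G) +
          Tq s false * hmmCond Tq (emitHalf n S) false (List.ofFn G)) *
        (Tq s' true * hmmCond Tq (emitHalf n S') true (List.ofFn G) +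
          Tq s' false * hmmCond Tq (emitHalf n S') false (List.ofFn G))) =
      ∑ u, ∑ u', Tq s u * Tq s' u' * ∑ G : Fin k → Fin n,
        hmmCond Tq (emitHalf n S) u (List.ofFn G) * hmmCond Tq (emitHalf n S') u' (List.ofFn G) := by
    simp only [Fintype.sum_bool, Finset.mul_sum, ← Finset.sum_add_distrib]
    refine Finset.sum_congr rfl fun G _ => ?_
    ring
  rw [h2]
  simp only [Fintype.sum_bool]
  ring

/-- The average of the two correlations (equal and opposite hidden states) grows at most
geometrically, at rate `1 + r ^ 2 / 3` for normalised overlap `r`. -/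
lemma exists_hmmCorr_eq {n m : ℕ} (hn : n = 2 * m) (hm : 0 < m) {S S' : Finset (Fin n)}
    (hS : S.card = m) (hS' : S'.card = m) (k : ℕ) :
    ∃ x d : ℝ, (∀ s s', hmmCorr n k S S' s s' = x + stateSign s * stateSign s' * d) ∧
      0 ≤ x ∧ x ≤ (1 + (signedOverlap S S' / m) ^ 2 / 3) ^ k ∧
      0 ≤ signedOverlap S S' / m * d / 4 ∧
      signedOverlap S S' / m * d / 4 ≤ (signedOverlap S S' / m) ^ 2 / 3 * x := by
  set r := signedOverlap S S' / m with hr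
  induction k with
  | zero => exact ⟨1, 0, fun s s' => by simp [hmmCorr, hmmCond], by simp, by simp, by simp,
      by simp only [mul_zero, zero_div, mul_one]; positivity⟩
  | succ k ih =>
    obtain ⟨x, d, hxd, hx0, hxk, hv0, hv⟩ := ih
    refine ⟨x + r * d / 4, d / 4 + r * x, ?_, by positivity, ?_, ?_, ?_⟩
    · intro s s'
      rw [hmmCorr_succ hn hm hS hS']
      simp only [hxd, Fintype.sum_bool, ← hr]
      cases s <;> cases s' <;> simp [Tq, stateSign] <;> ring
    · rw [pow_succ]
      nlinarith [mul_le_mul_of_nonneg_right hxk (show 0 ≤ 1 + r ^ 2 / 3 by positivity)]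
    · nlinarith [mul_nonneg (sq_nonneg r) hx0]
    · nlinarith [mul_nonneg (sq_nonneg r) hx0, mul_nonneg (sq_nonneg r) hv0]

lemma sum_hmmLaw_mul_hmmLaw_le {n m : ℕ} (hn : n = 2 * m) (hm : 0 < m) {S S' : Finset (Fin n)}
    (hS : S.card = m) (hS' : S'.card = m) (k : ℕ) :
    (n : ℝ) ^ k * ∑ G : Fin k → Fin n, hmmLaw Tq (fun _ => 1 / 2) (emitHalf n S) (List.ofFn G) *
      hmmLaw Tq (fun _ => 1 / 2) (emitHalf n S') (List.ofFn G) ≤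
      Real.exp (k * ((signedOverlap S S' / m) ^ 2 / 3)) := by
  obtain ⟨x, d, hxd, -, hxk, -, -⟩ := exists_hmmCorr_eq hn hm hS hS' k
  have h : (n : ℝ) ^ k * ∑ G : Fin k → Fin n,
      hmmLaw Tq (fun _ => 1 / 2) (emitHalf n S) (List.ofFn G) *
      hmmLaw Tq (fun _ => 1 / 2) (emitHalf n S') (List.ofFn G) =
      ∑ s, ∑ s', 1 / 4 * hmmCorr n k S S' s s' := by
    simp only [hmmCorr, hmmLaw, Fintype.sum_bool, Finset.mul_sum, ← Finset.sum_add_distrib]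
    refine Finset.sum_congr rfl fun G _ => ?_
    ring
  rw [h]
  simp only [hxd, Fintype.sum_bool]
  calc _ = x := by simp [stateSign]; ring
    _ ≤ _ := hxk
    _ ≤ Real.exp ((signedOverlap S S' / m) ^ 2 / 3) ^ k := by
      gcongr
      linarith [Real.add_one_le_exp ((signedOverlap S S' / m) ^ 2 / 3)]
    _ = _ := by rw [← Real.exp_nat_mul]

lemma choose_mul_centralBinom_le (p i : ℕ) :
    (p + i).choose i * 4 ^ i * p.centralBinom ≤ (p + i + 1).choose i * (p + i).centralBinom := by
  induction i with
  | zero => simp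
  | succ i ih =>
    have h1 : (p + i + 1).choose (i + 1) * (i + 1) = (p + i + 1) * (p + i).choose i :=
      (Nat.add_one_mul_choose_eq (p + i) i).symm
    have h2 : (p + i + 1 + 1).choose (i + 1) * (i + 1) = (p + i + 1 + 1) * (p + i + 1).choose i :=
      (Nat.add_one_mul_choose_eq (p + i + 1) i).symm
    have h3 := Nat.succ_mul_centralBinom_succ (p + i)
    have hpos : 0 < (i + 1) * (p + i + 1) := by positivity
    refine Nat.le_of_mul_le_mul_left ?_ hpos
    rw [← add_assoc]
    calc (i + 1) * (p + i + 1) * ((p + i + 1).choose (i + 1) * 4 ^ (i + 1) * p.centralBinom)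
        = ((p + i + 1).choose (i + 1) * (i + 1)) * (p + i + 1) * 4 ^ (i + 1) * p.centralBinom := by
          ring
      _ = 4 * (p + i + 1) ^ 2 * ((p + i).choose i * 4 ^ i * p.centralBinom) := by
          rw [h1]; ring
      _ ≤ 4 * (p + i + 1) ^ 2 * ((p + i + 1).choose i * (p + i).centralBinom) := by gcongr
      _ ≤ ((p + i + 1 + 1) * (2 * (2 * (p + i) + 1))) *
            ((p + i + 1).choose i * (p + i).centralBinom) := by
          refine Nat.mul_le_mul_right _ ?_
          nlinarith
      _ = ((p + i + 1 + 1) * (p + i + 1).choose i) *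
            (2 * (2 * (p + i) + 1) * (p + i).centralBinom) := by ring
      _ = (i + 1) * (p + i + 1) * ((p + i + 1 + 1).choose (i + 1) * (p + i + 1).centralBinom) := by
          rw [← h2, ← h3]; ring

open Polynomial in
lemma sum_powersetCard_prod_eq_coeff {n : ℕ} (w : Fin n → ℝ) (m : ℕ) :
    ∑ S ∈ (Finset.univ : Finset (Fin n)).powersetCard m, ∏ i ∈ S, w i =
      (∏ i, (1 + C (w i) * X)).coeff m := by
  rw [Finset.prod_one_add, Polynomial.finsetSum_coeff, ← Finset.sum_filter_add_sum_filter_not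
    Finset.univ.powerset (fun S => S.card = m), ← Finset.powersetCard_eq_filter]
  rw [Finset.sum_eq_zero (s := Finset.filter _ _), add_zero]
  · refine Finset.sum_congr rfl fun S hS => ?_
    rw [Finset.mem_powersetCard] at hS
    rw [Finset.prod_mul_distrib, Finset.prod_const, hS.2, ← map_prod, coeff_C_mul, coeff_X_pow]
    simp
  · intro S hS
    rw [Finset.mem_filter] at hS
    rw [Finset.prod_mul_distrib, Finset.prod_const, ← map_prod, coeff_C_mul, coeff_X_pow,
      if_neg (fun h => hS.2 h.symm), mul_zero]

open Polynomial in
lemma coeff_prod_eq_sum_centralBinom (m : ℕ) (a : ℝ) :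
    (((1 + X) ^ 2 + C a * X : ℝ[X]) ^ m).coeff m =
      ∑ i ∈ Finset.range (m + 1), (m.choose i : ℝ) * a ^ i * (m - i).centralBinom := by
  rw [add_comm, add_pow, Polynomial.finsetSum_coeff]
  refine Finset.sum_congr rfl fun i hi => ?_
  obtain ⟨p, rfl⟩ := Nat.exists_eq_add_of_le (Nat.lt_succ_iff.mp (Finset.mem_range.mp hi))
  have h : (C a * X) ^ i * ((1 + X) ^ 2) ^ (i + p - i) * (((i + p).choose i : ℕ) : ℝ[X]) =
      C (((i + p).choose i : ℝ) * a ^ i) * ((1 + X) ^ (2 * p) * X ^ i) := by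
    simp only [Nat.add_sub_cancel_left, map_mul, map_pow, map_natCast, ← pow_mul]
    ring
  rw [h, coeff_C_mul, add_comm i p, coeff_mul_X_pow, coeff_one_add_X_pow, Nat.add_sub_cancel,
    Nat.centralBinom]

lemma sum_exp_signedOverlap_le {n m : ℕ} (hn : n = 2 * m) {S : Finset (Fin n)} (hS : S.card = m)
    (t : ℝ) :
    ∑ S' ∈ (Finset.univ : Finset (Fin n)).powersetCard m, Real.exp (t * signedOverlap S S') ≤
      m.centralBinom * Real.exp (t ^ 2 * (m + 1) / 4) := by
  have h1 : ∀ S' : Finset (Fin n),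
      Real.exp (t * signedOverlap S S') = ∏ i ∈ S', Real.exp (t * memSign S i) := by
    intro S'
    rw [signedOverlap, Finset.mul_sum, Real.exp_sum]
  have hScompl : Sᶜ.card = m := by
    rw [Finset.card_compl, hS, Fintype.card_fin]
    omega
  have h2 : ∏ i, (1 + Polynomial.C (Real.exp (t * memSign S i)) * Polynomial.X) =
      ((1 + Polynomial.X) ^ 2 + Polynomial.C (4 * Real.sinh (t / 2) ^ 2) * Polynomial.X) ^ m := by
    rw [← Finset.prod_mul_prod_compl S]
    rw [Finset.prod_congr rfl (g := fun _ => 1 + Polynomial.C (Real.exp t) * Polynomial.X),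
      Finset.prod_congr (s₁ := Sᶜ) rfl
        (g := fun _ => 1 + Polynomial.C (Real.exp (-t)) * Polynomial.X),
      Finset.prod_const, Finset.prod_const, hS, hScompl, ← mul_pow]
    · congr 1
      have e1 : Real.exp t * Real.exp (-t) = 1 := by rw [← Real.exp_add]; simp
      have e2 : 4 * Real.sinh (t / 2) ^ 2 = Real.exp t + Real.exp (-t) - 2 := by
        have := Real.cosh_two_mul (t / 2)
        rw [mul_div_cancel₀ _ (two_ne_zero), Real.cosh_eq, Real.cosh_sq] at this
        linarith
      rw [e2]
      have e3 : (Polynomial.C (Real.exp t) * Polynomial.C (Real.exp (-t)) : Polynomial ℝ) = 1 := by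
        rw [← map_mul, e1, map_one]
      simp only [map_add, map_sub, Polynomial.C_ofNat]
      linear_combination (Polynomial.X ^ 2 : Polynomial ℝ) * e3
    · intro i hi
      simp [memSign, Finset.mem_compl.mp hi]
    · intro i hi
      simp [memSign, hi]
  simp only [h1]
  rw [sum_powersetCard_prod_eq_coeff, h2, coeff_prod_eq_sum_centralBinom]
  have h3 : ∀ i ∈ Finset.range (m + 1),
      (m.choose i : ℝ) * (4 * Real.sinh (t / 2) ^ 2) ^ i * (m - i).centralBinom ≤
        m.centralBinom * ((Real.sinh (t / 2) ^ 2) ^ i * ((m + 1).choose i : ℝ)) := by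
    intro i hi
    obtain ⟨p, rfl⟩ := Nat.exists_eq_add_of_le' (Nat.lt_succ_iff.mp (Finset.mem_range.mp hi))
    have h := choose_mul_centralBinom_le p i
    have h' : (((p + i).choose i : ℝ) * 4 ^ i * p.centralBinom) ≤
      ((p + i + 1).choose i : ℝ) * (p + i).centralBinom := by exact_mod_cast h
    rw [Nat.add_sub_cancel, mul_pow]
    have h0 : 0 ≤ (Real.sinh (t / 2) ^ 2) ^ i := by positivity
    nlinarith [mul_le_mul_of_nonneg_left h' h0]
  calc _ ≤ _ := Finset.sum_le_sum h3
    _ ≤ m.centralBinom * ∑ i ∈ Finset.range (m + 1 + 1),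
          (Real.sinh (t / 2) ^ 2) ^ i * ((m + 1).choose i : ℝ) := by
        rw [← Finset.mul_sum, Finset.sum_range_succ _ (m + 1)]
        gcongr
        have : 0 ≤ (Real.sinh (t / 2) ^ 2) ^ (m + 1) * ((m + 1).choose (m + 1) : ℝ) := by
          positivity
        linarith
    _ = m.centralBinom * (Real.cosh (t / 2) ^ 2) ^ (m + 1) := by
        rw [Real.cosh_sq, add_pow]
        simp
    _ ≤ m.centralBinom * (Real.exp ((t / 2) ^ 2 / 2) ^ 2) ^ (m + 1) := by
        gcongr
        exact Real.cosh_le_exp_half_sq _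
    _ = _ := by
        rw [← pow_mul, ← Real.exp_nat_mul]
        congr 2
        push_cast
        ring

open MeasureTheory ProbabilityTheory in
lemma integral_exp_mul_gaussianReal (u : ℝ) :
    ∫ g, Real.exp (u * g) ∂(gaussianReal 0 1) = Real.exp (u ^ 2 / 2) := by
  have h := congrFun (mgf_fun_id_gaussianReal (μ := 0) (v := 1)) u
  simpa [mgf] using h

open MeasureTheory ProbabilityTheory in
lemma integral_exp_sq_gaussianReal {β : ℝ} (hβ : β < 1) :
    Integrable (fun g => Real.exp (β * g ^ 2 / 2)) (gaussianReal 0 1) ∧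
      ∫ g, Real.exp (β * g ^ 2 / 2) ∂(gaussianReal 0 1) = 1 / Real.sqrt (1 - β) := by
  have hpdf : ∀ g : ℝ, gaussianPDFReal 0 1 g * Real.exp (β * g ^ 2 / 2) =
      (Real.sqrt (2 * Real.pi))⁻¹ * Real.exp (-((1 - β) / 2) * g ^ 2) := by
    intro g
    rw [gaussianPDFReal, mul_assoc, ← Real.exp_add]
    congr 2
    · simp
    · simp
      ring
  have hb : 0 < (1 - β) / 2 := by linarith
  constructor
  · rw [gaussianReal_of_var_ne_zero 0 one_ne_zero, integrable_withDensity_iff_integrable_smul']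
    · simp only [toReal_gaussianPDF, smul_eq_mul, hpdf]
      exact (integrable_exp_neg_mul_sq hb).const_mul _
    · exact measurable_gaussianPDF 0 1
    · exact ae_of_all _ fun x => gaussianPDF_lt_top
  · rw [integral_gaussianReal_eq_integral_smul one_ne_zero]
    simp only [smul_eq_mul, hpdf]
    rw [integral_const_mul, integral_gaussian, one_div, ← Real.sqrt_inv, ← Real.sqrt_inv,
      ← Real.sqrt_mul (by positivity)]
    congr 1
    have : 1 - β ≠ 0 := by linarith
    field_simp

open MeasureTheory ProbabilityTheory in
lemma sum_exp_signedOverlap_sq_le {n m : ℕ} (hn : n = 2 * m) {S : Finset (Fin n)}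
    (hS : S.card = m) {s : ℝ} (hs : 0 ≤ s) (hs1 : s * (m + 1) < 1) :
    ∑ S' ∈ (Finset.univ : Finset (Fin n)).powersetCard m, Real.exp (s * signedOverlap S S' ^ 2) ≤
      m.centralBinom * (1 / Real.sqrt (1 - s * (m + 1))) := by
  obtain ⟨hint, hval⟩ := integral_exp_sq_gaussianReal hs1
  have hsq : Real.sqrt (2 * s) ^ 2 = 2 * s := Real.sq_sqrt (by positivity)
  have h1 : ∀ S' : Finset (Fin n), Real.exp (s * signedOverlap S S' ^ 2) =
      ∫ g, Real.exp ((Real.sqrt (2 * s) * signedOverlap S S') * g) ∂(gaussianReal 0 1) := by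
    intro S'
    rw [integral_exp_mul_gaussianReal, mul_pow, hsq]
    congr 1
    ring
  simp only [h1]
  rw [← integral_finsetSum _ fun S' _ => integrable_exp_mul_gaussianReal _, ← hval,
    ← integral_const_mul]
  refine integral_mono (integrable_finsetSum _ fun S' _ => integrable_exp_mul_gaussianReal _)
    (hint.const_mul _) fun g => ?_
  have h := sum_exp_signedOverlap_le hn hS (Real.sqrt (2 * s) * g)
  rw [mul_pow, hsq] at h
  calc _ = _ := Finset.sum_congr rfl fun S' _ => by rw [mul_right_comm]
    _ ≤ _ := h
    _ = _ := by
      congr 2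
      ring

lemma sum_Punif {n : ℕ} (hn : 0 < n) (k : ℕ) : ∑ G : Fin k → Fin n, Punif n k G = 1 := by
  have : (n : ℝ) ≠ 0 := by exact_mod_cast hn.ne'
  simp only [Punif, Finset.sum_const, Finset.card_univ, Fintype.card_fun, Fintype.card_fin,
    nsmul_eq_mul]
  push_cast
  rw [← mul_pow, mul_one_div_cancel this, one_pow]

lemma card_powersetCard_half {n m : ℕ} (hn : n = 2 * m) :
    ((Finset.univ : Finset (Fin n)).powersetCard m).card = m.centralBinom := by
  rw [Finset.card_powersetCard, Finset.card_univ, Fintype.card_fin, Nat.centralBinom, hn]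

lemma sum_Pmix {n m : ℕ} (hn : n = 2 * m) (hm : 0 < m) (k : ℕ) :
    ∑ G : Fin k → Fin n, Pmix n k G = 1 := by
  have hnm : n / 2 = m := by omega
  simp only [Pmix, hnm, ← Finset.sum_div]
  have hT : ∀ s, ∑ s', Tq s s' = 1 := by
    intro s
    cases s <;> norm_num [Tq]
  rw [Finset.sum_comm, Finset.sum_congr rfl (g := fun _ => (1 : ℝ)), Finset.sum_const,
    nsmul_eq_mul, mul_one, div_self]
  · rw [card_powersetCard_half hn]
    exact_mod_cast (Nat.centralBinom_pos m).ne'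
  · intro S hS
    have hS' := (Finset.mem_powersetCard.mp hS).2
    simp only [hmmLaw, Fintype.sum_bool, Finset.sum_add_distrib, ← Finset.mul_sum,
      sum_hmmCond hT (sum_emitHalf hn hm hS')]
    norm_num

lemma Pmix_nonneg (n k : ℕ) (G : Fin k → Fin n) : 0 ≤ Pmix n k G := by
  have h : ∀ (S : Finset (Fin n)) (l : List (Fin n)) (s : Bool),
      0 ≤ hmmCond Tq (emitHalf n S) s l := by
    intro S l
    induction l with
    | nil => intro s; simp [hmmCond]
    | cons x xs ih =>
      intro s
      rw [hmmCond]
      refine mul_nonneg ?_ (Finset.sum_nonneg fun s' _ => mul_nonneg ?_ (ih s'))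
      · unfold emitHalf
        split_ifs <;> positivity
      · unfold Tq
        split_ifs <;> positivity
  exact div_nonneg (Finset.sum_nonneg fun S _ => Finset.sum_nonneg fun s _ =>
    mul_nonneg (by norm_num) (h S _ s)) (Nat.cast_nonneg _)

/-- The second moment of the likelihood ratio is controlled by the overlap of two independent
half-subsets. -/
lemma sum_Pmix_sq_le {n m k : ℕ} (hn : n = 2 * m) (hm : 0 < m) {s : ℝ} (hs : 0 ≤ s)
    (hks : (k : ℝ) / (3 * m ^ 2) ≤ s) (hs1 : s * (m + 1) < 1) :
    (n : ℝ) ^ k * ∑ G : Fin k → Fin n, Pmix n k G ^ 2 ≤ 1 / Real.sqrt (1 - s * (m + 1)) := by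
  have hnm : n / 2 = m := by omega
  have hN : (0 : ℝ) < m.centralBinom := by exact_mod_cast Nat.centralBinom_pos m
  set A := (Finset.univ : Finset (Fin n)).powersetCard m with hA
  have h1 : (n : ℝ) ^ k * ∑ G : Fin k → Fin n, Pmix n k G ^ 2 =
      (∑ S ∈ A, ∑ S' ∈ A, (n : ℝ) ^ k * ∑ G : Fin k → Fin n,
        hmmLaw Tq (fun _ => 1 / 2) (emitHalf n S) (List.ofFn G) *
          hmmLaw Tq (fun _ => 1 / 2) (emitHalf n S') (List.ofFn G)) / (m.centralBinom : ℝ) ^ 2 := by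
    simp only [Pmix, hnm, ← hA, div_pow, ← Finset.sum_div, ← Finset.mul_sum]
    rw [card_powersetCard_half hn, mul_div_assoc]
    congr 2
    simp only [pow_two, Finset.sum_mul_sum]
    rw [Finset.sum_comm]
    exact Finset.sum_congr rfl fun S _ => Finset.sum_comm
  rw [h1, div_le_iff₀ (by positivity)]
  calc _ ≤ ∑ S ∈ A, (m.centralBinom * (1 / Real.sqrt (1 - s * (m + 1)))) := by
        refine Finset.sum_le_sum fun S hS => ?_
        have hS1 := (Finset.mem_powersetCard.mp hS).2
        refine le_trans (Finset.sum_le_sum fun S' hS' => ?_)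
          (sum_exp_signedOverlap_sq_le hn hS1 hs hs1)
        refine (sum_hmmLaw_mul_hmmLaw_le hn hm hS1 (Finset.mem_powersetCard.mp hS').2 k).trans ?_
        rw [Real.exp_le_exp]
        calc _ = (k : ℝ) / (3 * m ^ 2) * signedOverlap S S' ^ 2 := by
              field_simp
          _ ≤ _ := by gcongr
    _ = _ := by
        rw [Finset.sum_const, card_powersetCard_half hn, nsmul_eq_mul]
        ring

lemma sum_abs_sub_le {n m k : ℕ} (hn : n = 2 * m) (hm : 0 < m) {s : ℝ} (hs : 0 ≤ s)
    (hks : (k : ℝ) / (3 * m ^ 2) ≤ s) (hs1 : s * (m + 1) < 1) :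
    ∑ G : Fin k → Fin n, |Pmix n k G - Punif n k G| ≤
      Real.sqrt (1 / Real.sqrt (1 - s * (m + 1)) - 1) := by
  have hn0 : 0 < n := by omega
  have hn0' : (n : ℝ) ≠ 0 := by exact_mod_cast hn0.ne'
  refine Real.le_sqrt_of_sq_le ?_
  refine (sq_sum_le_card_mul_sum_sq).trans ?_
  have hc : (n : ℝ) ^ k * (1 / (n : ℝ)) ^ k = 1 := by
    rw [← mul_pow, mul_one_div_cancel hn0', one_pow]
  have h : ∀ G : Fin k → Fin n, |Pmix n k G - Punif n k G| ^ 2 =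
      Pmix n k G ^ 2 - 2 * (1 / (n : ℝ)) ^ k * Pmix n k G + (1 / (n : ℝ)) ^ k * Punif n k G := by
    intro G
    rw [sq_abs]
    unfold Punif
    ring
  simp only [h, Finset.sum_add_distrib, Finset.sum_sub_distrib, ← Finset.mul_sum, sum_Punif hn0,
    sum_Pmix hn hm, Finset.card_univ, Fintype.card_fun, Fintype.card_fin]
  push_cast
  have := sum_Pmix_sq_le hn hm hs hks hs1
  linarith

/-- The success probability of any test, in terms of the total variation distance. -/
lemma min_sum_le {α : Type*} [Fintype α] (p q : α → ℝ) (hp : ∑ x, p x = 1) (hq : ∑ x, q x = 1)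
    (test : α → Bool) :
    min (∑ x ∈ Finset.univ.filter (fun x => test x = false), q x)
      (∑ x ∈ Finset.univ.filter (fun x => test x = true), p x) ≤
      1 / 2 + 1 / 2 * (1 / 2 * ∑ x, |p x - q x|) := by
  have hsplit : ∀ f : α → ℝ, (∑ x ∈ Finset.univ.filter (fun x => test x = false), f x) +
      (∑ x ∈ Finset.univ.filter (fun x => test x = true), f x) = ∑ x, f x := by
    intro f
    rw [← Finset.sum_filter_add_sum_filter_not Finset.univ (fun x => test x = false)]
    simp
  have hf : |∑ x ∈ Finset.univ.filter (fun x => test x = false), (p x - q x)| ≤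
      ∑ x ∈ Finset.univ.filter (fun x => test x = false), |p x - q x| :=
    Finset.abs_sum_le_sum_abs _ _
  have ht : |∑ x ∈ Finset.univ.filter (fun x => test x = true), (p x - q x)| ≤
      ∑ x ∈ Finset.univ.filter (fun x => test x = true), |p x - q x| :=
    Finset.abs_sum_le_sum_abs _ _
  have h1 := hsplit fun x => |p x - q x|
  have h2 := hsplit p
  have h3 := hsplit q
  rw [Finset.sum_sub_distrib] at hf ht
  have hf' := (neg_le_abs _).trans hf
  have ht' := (le_abs_self _).trans ht
  linarith [min_le_left (∑ x ∈ Finset.univ.filter (fun x => test x = false), q x)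
      (∑ x ∈ Finset.univ.filter (fun x => test x = true), p x),
    min_le_right (∑ x ∈ Finset.univ.filter (fun x => test x = false), q x)
      (∑ x ∈ Finset.univ.filter (fun x => test x = true), p x)]

/-- The `o(1)` error term of the total variation bound. -/
def tvError (c : ℝ) (n : ℕ) : ℝ :=
  if 2 * c / 3 * (1 + 2 / (n : ℝ)) < 1 then
    1 / 2 * Real.sqrt (1 / Real.sqrt (1 - 2 * c / 3 * (1 + 2 / (n : ℝ))) - 1) -
      1 / 2 * Real.sqrt (Real.sqrt (2 / (2 - 4 * c / 3)) - 1)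
  else 1

lemma tendsto_tvError {c : ℝ} (hc : c < 3 / 2) : Tendsto (tvError c) atTop (nhds 0) := by
  have h0 : Tendsto (fun n : ℕ => 2 * c / 3 * (1 + 2 / (n : ℝ))) atTop (nhds (2 * c / 3)) := by
    have h := ((tendsto_const_div_atTop_nhds_zero_nat (2 : ℝ)).const_add 1).const_mul (2 * c / 3)
    simpa using h
  have hlt : 2 * c / 3 < 1 := by linarith
  have hpos : 0 < 1 - 2 * c / 3 := by linarith
  have h1 : Tendsto (fun n : ℕ =>
      1 / 2 * Real.sqrt (1 / Real.sqrt (1 - 2 * c / 3 * (1 + 2 / (n : ℝ))) - 1) -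
        1 / 2 * Real.sqrt (Real.sqrt (2 / (2 - 4 * c / 3)) - 1)) atTop (nhds 0) := by
    have hdiv := (tendsto_const_nhds (x := (1 : ℝ))).div (h0.const_sub 1).sqrt
      (Real.sqrt_pos.mpr hpos).ne'
    have h := ((hdiv.sub_const 1).sqrt.const_mul (1 / 2)).sub_const
      (1 / 2 * Real.sqrt (Real.sqrt (2 / (2 - 4 * c / 3)) - 1))
    have he : 1 / Real.sqrt (1 - 2 * c / 3) = Real.sqrt (2 / (2 - 4 * c / 3)) := by
      rw [one_div, ← Real.sqrt_inv]
      congr 1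
      have : 2 - 4 * c / 3 = 2 * (1 - 2 * c / 3) := by ring
      rw [this]
      field_simp
    rwa [he, sub_self] at h
  refine h1.congr' ?_
  filter_upwards [h0.eventually_lt_const hlt] with n hn
  rw [tvError, if_pos hn]

lemma tv_le {c : ℝ} (hc0 : 0 ≤ c) {n : ℕ} (hn : Even n) (hn0 : 0 < n) :
    (1 / 2) * (∑ G : Fin (Nat.floor (c * n)) → Fin n,
        |Pmix n (Nat.floor (c * n)) G - Punif n (Nat.floor (c * n)) G|) ≤
      (1 / 2) * Real.sqrt (Real.sqrt (2 / (2 - 4 * c / 3)) - 1) + tvError c n := by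
  obtain ⟨m, hm⟩ := hn.exists_two_nsmul
  rw [smul_eq_mul] at hm
  have hm0 : 0 < m := by omega
  have hmr : (0 : ℝ) < m := by exact_mod_cast hm0
  have hnm : (n : ℝ) = 2 * m := by exact_mod_cast hm
  unfold tvError
  split_ifs with h
  · have hs : 2 * c / (3 * m) * ((m : ℝ) + 1) = 2 * c / 3 * (1 + 2 / (n : ℝ)) := by
      rw [hnm]
      field_simp
    have hk : ((Nat.floor (c * n) : ℕ) : ℝ) / (3 * (m : ℝ) ^ 2) ≤ 2 * c / (3 * m) := by
      have := Nat.floor_le (show 0 ≤ c * (n : ℝ) by positivity)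
      calc _ ≤ c * n / (3 * (m : ℝ) ^ 2) := by gcongr
        _ = _ := by
          rw [hnm]
          field_simp
    have := sum_abs_sub_le hm hm0 (by positivity) hk (by rwa [hs])
    rw [hs] at this
    linarith
  · have : ∑ G : Fin (Nat.floor (c * n)) → Fin n,
        |Pmix n (Nat.floor (c * n)) G - Punif n (Nat.floor (c * n)) G| ≤ 1 + 1 := by
      rw [← sum_Pmix hm hm0 (Nat.floor (c * n))]
      nth_rw 2 [sum_Pmix hm hm0 (Nat.floor (c * n))]
      rw [← sum_Punif hn0 (Nat.floor (c * n)), ← Finset.sum_add_distrib]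
      refine Finset.sum_le_sum fun G _ => (abs_sub _ _).trans ?_
      rw [abs_of_nonneg (Pmix_nonneg _ _ _), abs_of_nonneg]
      unfold Punif
      positivity
    have := Real.sqrt_nonneg (Real.sqrt (2 / (2 - 4 * c / 3)) - 1)
    linarith

/-- for `0 ≤ c < 3/2`, the total variation distance between the length-`⌊cn⌋`
HMM-mixture law `P_n` and the uniform law `P′_n` is at most
`(1/2)·√(√(2/(2 − 4c/3)) − 1) + o_n(1)`; consequently every test has worst-case success
probability at most `1/2` plus half that quantity. -/
theorem stmt16 (c : ℝ) (hc0 : 0 ≤ c) (hc : c < 3 / 2) :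
    ∃ f : ℕ → ℝ, Tendsto f atTop (nhds 0) ∧
      ∀ n : ℕ, Even n → 0 < n →
        (1 / 2) * (∑ G : Fin (Nat.floor (c * n)) → Fin n,
            |Pmix n (Nat.floor (c * n)) G - Punif n (Nat.floor (c * n)) G|) ≤
          (1 / 2) * Real.sqrt (Real.sqrt (2 / (2 - 4 * c / 3)) - 1) + f n ∧
        ∀ test : (Fin (Nat.floor (c * n)) → Fin n) → Bool,
          min
            (∑ G ∈ Finset.univ.filter (fun G => test G = false),
              Punif n (Nat.floor (c * n)) G)
            (∑ G ∈ Finset.univ.filter (fun G => test G = true),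
              Pmix n (Nat.floor (c * n)) G) ≤
            1 / 2 + (1 / 2) *
              ((1 / 2) * Real.sqrt (Real.sqrt (2 / (2 - 4 * c / 3)) - 1) + f n) := by
  refine ⟨tvError c, tendsto_tvError hc, fun n hn hn0 => ?_⟩
  have htv := tv_le hc0 hn hn0
  refine ⟨htv, fun test => ?_⟩
  obtain ⟨m, hm⟩ := hn.exists_two_nsmul
  rw [smul_eq_mul] at hm
  refine (min_sum_le _ _ (sum_Pmix hm (by omega) _) (sum_Punif hn0 _) test).trans ?_
  linarith
end
end
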